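/- Fix -1 = t₀ < t₁ < ⋯ < t_n < t_{n+1} = 1 and nonnegative reals p₀, …, p_n with Σ_{i=0}^{n} (t_{i+1}-t_i) p_i = 1, and let μ be the Borel probability measure on [-1,1] with piecewise constant density equal to p_i on [t_i, t_{i+1}). Let L, R ∈ ℝ and define f : ℝ → ℝ by f(x) = L·x for x ≤ 0 and f(x) = R·x for x > 0. For 0 ≤ i ≤ n+1 set X_i = L·μ([-1, t_i]) + R·μ([t_i, 1]). Then for every α > 0 the α-averaging f_α is twice differentiable at every x with x ∉ {-α·t_0, …, -α·t_{n+1}}, and: f″_α(x) = (X_i - X_{i+1}) / (α·(t_{i+1} - t_i)) for x ∈ (-α·t_{i+1}, -α·t_i), for each 0 ≤ i ≤ n; and f″_α(x) = 0 for x < -α and for x > α. -/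

import Mathlib

open MeasureTheory Set Filter

/-- The `α`-averaging of `f` by the measure `μ` (supported on `[-1,1]`):
`f_α(x) = ∫ f(x + tα) dμ(t)`. -/
noncomputable def avg (μ : Measure ℝ) (f : ℝ → ℝ) (α : ℝ) (x : ℝ) : ℝ :=
  ∫ t, f (x + t * α) ∂μ

/-- The measure on `ℝ` with piecewise constant density taking the value `p i`
on `[t i, t (i+1))`. -/
noncomputable def stepMeasure (n : ℕ) (t : Fin (n + 2) → ℝ) (p : Fin (n + 1) → ℝ) :
    Measure ℝ :=
  volume.withDensity fun x =>
    ENNReal.ofReal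
      (∑ i : Fin (n + 1), Set.indicator (Ico (t i.castSucc) (t i.succ)) (fun _ => p i) x)

lemma integrable_stepDensity (n : ℕ) (t : Fin (n + 2) → ℝ) (p : Fin (n + 1) → ℝ) :
    Integrable fun x =>
      ∑ i : Fin (n + 1), Set.indicator (Ico (t i.castSucc) (t i.succ)) (fun _ => p i) x := by
  refine integrable_finsetSum _ fun i _ => ?_
  rw [integrable_indicator_iff measurableSet_Ico]
  exact integrableOn_const (by simp)

instance isFiniteMeasure_stepMeasure (n : ℕ) (t : Fin (n + 2) → ℝ) (p : Fin (n + 1) → ℝ) :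
    IsFiniteMeasure (stepMeasure n t p) :=
  isFiniteMeasure_withDensity_ofReal (integrable_stepDensity n t p).2

lemma integral_stepMeasure {n : ℕ} {t : Fin (n + 2) → ℝ} {p : Fin (n + 1) → ℝ}
    (ht : StrictMono t) (hp : ∀ i, 0 ≤ p i) {g : ℝ → ℝ} (hg : Continuous g) :
    ∫ x, g x ∂stepMeasure n t p =
      ∑ i : Fin (n + 1), p i * ∫ x in (t i.castSucc)..(t i.succ), g x := by
  have hw : ∀ x, 0 ≤ ∑ i : Fin (n + 1),
      Set.indicator (Ico (t i.castSucc) (t i.succ)) (fun _ => p i) x := fun x =>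
    Finset.sum_nonneg fun i _ => Set.indicator_nonneg (fun _ _ => hp i) x
  have hmul : ∀ (i : Fin (n + 1)) (x : ℝ),
      Set.indicator (Ico (t i.castSucc) (t i.succ)) (fun _ => p i) x * g x =
        Set.indicator (Ico (t i.castSucc) (t i.succ)) (fun y => p i * g y) x := fun i x => by
    by_cases h : x ∈ Ico (t i.castSucc) (t i.succ) <;> simp [h]
  rw [stepMeasure, integral_withDensity_eq_integral_toReal_smul₀
    (integrable_stepDensity n t p).1.aemeasurable.ennreal_ofReal (by simp)]
  simp only [ENNReal.toReal_ofReal (hw _), smul_eq_mul, Finset.sum_mul, hmul]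
  rw [integral_finsetSum]
  · refine Finset.sum_congr rfl fun i _ => ?_
    rw [integral_indicator measurableSet_Ico, integral_const_mul, integral_Ico_eq_integral_Ioc,
      intervalIntegral.integral_of_le (ht i.castSucc_lt_succ).le]
  · intro i _
    rw [integrable_indicator_iff measurableSet_Ico]
    exact ((continuous_const.mul hg).integrableOn_Icc).mono_set Ico_subset_Icc_self

lemma stepDensity_eq {n : ℕ} {t : Fin (n + 2) → ℝ} (ht : StrictMono t) (p : Fin (n + 1) → ℝ)
    (i : Fin (n + 1)) {x : ℝ} (hx : x ∈ Ico (t i.castSucc) (t i.succ)) :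
    ∑ j : Fin (n + 1), Set.indicator (Ico (t j.castSucc) (t j.succ)) (fun _ => p j) x = p i := by
  rw [Finset.sum_eq_single i _ (by simp), Set.indicator_of_mem hx]
  intro j _ hj
  refine Set.indicator_of_notMem (fun hxj => ?_) _
  rcases lt_or_gt_of_ne hj with h | h
  · have := ht.monotone (show j.succ ≤ i.castSucc from Fin.succ_le_castSucc_iff.2 h)
    linarith [hx.1, hxj.2]
  · have := ht.monotone (show i.succ ≤ j.castSucc from Fin.succ_le_castSucc_iff.2 h)
    linarith [hxj.1, hx.2]

lemma stepMeasure_real_Ico {n : ℕ} {t : Fin (n + 2) → ℝ} {p : Fin (n + 1) → ℝ}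
    (ht : StrictMono t) (hp : ∀ i, 0 ≤ p i) (i : Fin (n + 1)) :
    (stepMeasure n t p).real (Ico (t i.castSucc) (t i.succ)) =
      (t i.succ - t i.castSucc) * p i := by
  rw [measureReal_def, stepMeasure, withDensity_apply _ measurableSet_Ico,
    setLIntegral_congr_fun measurableSet_Ico
      (fun x hx => congrArg ENNReal.ofReal (stepDensity_eq ht p i hx)),
    setLIntegral_const, Real.volume_Ico, ENNReal.toReal_mul, ENNReal.toReal_ofReal (hp i),
    ENNReal.toReal_ofReal (sub_nonneg.2 (ht i.castSucc_lt_succ).le), mul_comm]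

lemma stepMeasure_real_Ioc {n : ℕ} {t : Fin (n + 2) → ℝ} {p : Fin (n + 1) → ℝ}
    (ht : StrictMono t) (hp : ∀ i, 0 ≤ p i) (i : Fin (n + 1)) :
    (stepMeasure n t p).real (Ioc (t i.castSucc) (t i.succ)) =
      (t i.succ - t i.castSucc) * p i := by
  rw [← stepMeasure_real_Ico ht hp i]
  exact measureReal_congr ((withDensity_absolutelyContinuous _ _).ae_eq
    (Ioc_ae_eq_Icc.trans Ico_ae_eq_Icc.symm))

lemma hasDerivAt_avg_stepMeasure {n : ℕ} {t : Fin (n + 2) → ℝ} {p : Fin (n + 1) → ℝ}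
    (ht : StrictMono t) (hp : ∀ i, 0 ≤ p i) {f : ℝ → ℝ} (hf : Continuous f)
    {α : ℝ} (hα : α ≠ 0) (x : ℝ) :
    HasDerivAt (avg (stepMeasure n t p) f α)
      (∑ i : Fin (n + 1),
        p i * (α⁻¹ * (f (x + α * t i.succ) - f (x + α * t i.castSucc)))) x := by
  have hF : ∀ y, HasDerivAt (fun z => ∫ s in (0 : ℝ)..z, f s) (f y) y := fun y =>
    hf.integral_hasStrictDerivAt 0 y |>.hasDerivAt
  have havg : avg (stepMeasure n t p) f α = fun x => ∑ i : Fin (n + 1),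
      p i * (α⁻¹ * ((∫ s in (0 : ℝ)..(x + α * t i.succ), f s) -
        ∫ s in (0 : ℝ)..(x + α * t i.castSucc), f s)) := by
    funext x
    rw [avg, integral_stepMeasure ht hp (by fun_prop)]
    refine Finset.sum_congr rfl fun i _ => ?_
    rw [intervalIntegral.integral_interval_sub_left (hf.intervalIntegrable _ _)
      (hf.intervalIntegrable _ _), ← smul_eq_mul (α⁻¹),
      ← intervalIntegral.integral_comp_add_mul f hα x]
    simp only [mul_comm]
  rw [havg]
  exact HasDerivAt.fun_sum fun i _ =>
    ((((hF _).comp_add_const x _).sub ((hF _).comp_add_const x _)).const_mul _).const_mul _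

theorem averaging_second_deriv_of_LxRx
    (n : ℕ) (t : Fin (n + 2) → ℝ) (p : Fin (n + 1) → ℝ)
    (ht : StrictMono t) (ht0 : t 0 = -1) (htlast : t (Fin.last (n + 1)) = 1)
    (hp : ∀ i, 0 ≤ p i)
    (hsum : ∑ i : Fin (n + 1), (t i.succ - t i.castSucc) * p i = 1)
    (L R : ℝ) (f : ℝ → ℝ) (hf : ∀ x, f x = if x ≤ 0 then L * x else R * x)
    (X : Fin (n + 2) → ℝ)
    (hX : ∀ i, X i =
      L * (stepMeasure n t p (Icc (-1) (t i))).toReal +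
      R * (stepMeasure n t p (Icc (t i) 1)).toReal)
    (α : ℝ) (hα : 0 < α) :
    (∀ x, x < -α → HasDerivAt (deriv (avg (stepMeasure n t p) f α)) 0 x) ∧
    (∀ i : Fin (n + 1), ∀ x ∈ Ioo (-(α * t i.succ)) (-(α * t i.castSucc)),
      HasDerivAt (deriv (avg (stepMeasure n t p) f α))
        ((X i.castSucc - X i.succ) / (α * (t i.succ - t i.castSucc))) x) ∧
    (∀ x, α < x → HasDerivAt (deriv (avg (stepMeasure n t p) f α)) 0 x) := by
  have hfc : Continuous f := by
    rw [funext hf]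
    exact Continuous.if_le (by fun_prop) (by fun_prop) continuous_id continuous_const
      (by rintro x rfl; simp)
  have hneg : ∀ y < 0, HasDerivAt f L y := fun y hy => by
    refine ((hasDerivAt_id y).const_mul L).congr_of_eventuallyEq ?_ |>.congr_deriv (mul_one L)
    filter_upwards [Iio_mem_nhds hy] with z hz
    simp [hf z, (mem_Iio.1 hz).le]
  have hpos : ∀ y > 0, HasDerivAt f R y := fun y hy => by
    refine ((hasDerivAt_id y).const_mul R).congr_of_eventuallyEq ?_ |>.congr_deriv (mul_one R)
    filter_upwards [Ioi_mem_nhds hy] with z hz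
    simp [hf z, not_le.2 (mem_Ioi.1 hz)]
  have hderiv : deriv (avg (stepMeasure n t p) f α) = fun x => ∑ i : Fin (n + 1),
      p i * (α⁻¹ * (f (x + α * t i.succ) - f (x + α * t i.castSucc))) :=
    funext fun x => (hasDerivAt_avg_stepMeasure ht hp hfc hα.ne' x).deriv
  have hsecond : ∀ (c : Fin (n + 2) → ℝ) (x : ℝ), (∀ j, HasDerivAt f (c j) (x + α * t j)) →
      HasDerivAt (deriv (avg (stepMeasure n t p) f α))
        (∑ i : Fin (n + 1), p i * (α⁻¹ * (c i.succ - c i.castSucc))) x := fun c x hc => by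
    rw [hderiv]
    exact HasDerivAt.fun_sum fun i _ =>
      ((((hc _).comp_add_const x _).sub ((hc _).comp_add_const x _)).const_mul _).const_mul _
  have hge : ∀ j, -1 ≤ t j := fun j => ht0 ▸ ht.monotone (Fin.zero_le j)
  have hle : ∀ j, t j ≤ 1 := fun j => htlast ▸ ht.monotone (Fin.le_last j)
  refine ⟨fun x hx => ?_, fun i x hx => ?_, fun x hx => ?_⟩
  · simpa using hsecond (fun _ => L) x fun j => hneg _ (by nlinarith [hle j])
  · have hc := hsecond (fun j => if j ≤ i.castSucc then L else R) x fun j => by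
      split_ifs with hj
      · have := mul_le_mul_of_nonneg_left (ht.monotone hj) hα.le
        exact hneg _ (by linarith [hx.2])
      · have := mul_le_mul_of_nonneg_left
          (ht.monotone (Fin.castSucc_lt_iff_succ_le.1 (not_le.1 hj))) hα.le
        exact hpos _ (by linarith [hx.1])
    refine hc.congr_deriv ?_
    have hlt : t i.castSucc < t i.succ := ht i.castSucc_lt_succ
    have hleft : (stepMeasure n t p).real (Icc (-1) (t i.succ)) =
        (stepMeasure n t p).real (Icc (-1) (t i.castSucc)) +
          (t i.succ - t i.castSucc) * p i := by
      rw [← stepMeasure_real_Ioc ht hp i, ← measureReal_union _ measurableSet_Ioc,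
        Icc_union_Ioc_eq_Icc (hge _) hlt.le]
      exact Set.disjoint_left.2 fun y hy hy' => hy'.1.not_ge hy.2
    have hright : (stepMeasure n t p).real (Icc (t i.castSucc) 1) =
        (t i.succ - t i.castSucc) * p i +
          (stepMeasure n t p).real (Icc (t i.succ) 1) := by
      rw [← stepMeasure_real_Ico ht hp i, ← measureReal_union _ measurableSet_Icc,
        Ico_union_Icc_eq_Icc hlt.le (hle _)]
      exact Set.disjoint_left.2 fun y hy hy' => hy.2.not_ge hy'.1
    rw [Finset.sum_eq_single i _ (by simp), hX, hX]
    · simp only [← measureReal_def, hleft, hright]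
      have hd : t i.succ - t i.castSucc ≠ 0 := (sub_pos.2 hlt).ne'
      rw [if_pos le_rfl, if_neg (not_le.2 i.castSucc_lt_succ)]
      field_simp
      ring
    · intro j _ hj
      have hiff : j.succ ≤ i.castSucc ↔ j.castSucc ≤ i.castSucc := by
        rw [Fin.succ_le_castSucc_iff, Fin.castSucc_le_castSucc_iff]
        exact ⟨le_of_lt, fun h => lt_of_le_of_ne h hj⟩
      simp [hiff]
  · simpa using hsecond (fun _ => R) x fun j => hpos _ (by nlinarith [hge j])
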